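/- Every finite non-abelian group that is generated by two elements admits an oriented m-semiregular representation (OmSR) of valency two for every integer m ≥ 2. -/

import Mathlib

/-- The arc relation of the `m`-Cayley digraph `Cay(G, T_{i,j} : i,j ∈ Z_m)`:
there is an arc from `(g,i)` to `(t*g, j)` for each `t ∈ T i j`. -/
def mCayleyArc {G : Type*} [Group G] {m : ℕ} (T : ZMod m → ZMod m → Set G) :
    G × ZMod m → G × ZMod m → Prop :=
  fun x y => ∃ t ∈ T x.2 y.2, y.1 = t * x.1

/-- A permutation `σ` of the vertex set is an automorphism of the digraph with
arc relation `A` if it preserves the arc relation. -/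
def IsDigraphAuto {V : Type*} (A : V → V → Prop) (σ : Equiv.Perm V) : Prop :=
  ∀ x y : V, A (σ x) (σ y) ↔ A x y

/-- A digraph is oriented if there are no loops and no pair of oppositely
directed arcs between any two vertices. -/
def IsOrientedRel {V : Type*} (A : V → V → Prop) : Prop :=
  ∀ x y : V, A x y → ¬ A y x

/-- The right translation `R(h) : (g,i) ↦ (g*h, i)` on the vertex set `G × Z_m`. -/
def rightTransl {G : Type*} [Group G] (m : ℕ) (h : G) : Equiv.Perm (G × ZMod m) :=
  (Equiv.mulRight h).prodCongr (Equiv.refl (ZMod m))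

/-- `G` admits an oriented `m`-semiregular representation (OmSR) of valency two:
there are connection sets `T i j ⊆ G` such that the corresponding `m`-Cayley
digraph is oriented, every vertex has exactly two out-neighbours and exactly two
in-neighbours, and the full automorphism group consists exactly of the right
translations `R(h)`, `h ∈ G`. -/
def HasOmSRValencyTwo (G : Type*) [Group G] (m : ℕ) : Prop :=
  ∃ T : ZMod m → ZMod m → Set G,
    IsOrientedRel (mCayleyArc T) ∧
    (∀ x : G × ZMod m, {y | mCayleyArc T x y}.ncard = 2) ∧
    (∀ x : G × ZMod m, {y | mCayleyArc T y x}.ncard = 2) ∧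
    (∀ σ : Equiv.Perm (G × ZMod m),
      IsDigraphAuto (mCayleyArc T) σ ↔ ∃ h : G, σ = rightTransl m h)

/-- A group generated by two commuting elements is commutative. -/
theorem commute_of_closure_pair_eq_top {G : Type*} [Group G] {a b : G}
    (hgen : Subgroup.closure {a, b} = ⊤) (hab : a * b = b * a) (x y : G) :
    x * y = y * x := by
  have hx : x ∈ Subgroup.closure {a, b} := hgen ▸ Subgroup.mem_top x
  have hy : y ∈ Subgroup.closure {a, b} := hgen ▸ Subgroup.mem_top y
  induction hx, hy using Subgroup.closure_induction₂ with
  | mem u v hu hv =>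
    rcases hu with rfl | rfl <;> rcases hv with rfl | rfl <;> first | rfl | exact hab | exact hab.symm
  | one_left => simp
  | one_right => simp
  | mul_left _ _ _ _ _ _ h₁ h₂ => exact Commute.mul_left h₁ h₂
  | mul_right _ _ _ _ _ _ h₁ h₂ => exact Commute.mul_right h₁ h₂
  | inv_left _ _ _ _ h => exact Commute.inv_left h
  | inv_right _ _ _ _ h => exact Commute.inv_right h

/-- A non-abelian two-generated group has a pair of non-commuting generators the first of which
is not an involution. -/
theorem exists_generators_sq_ne_one {G : Type*} [Group G] (hna : ∃ x y : G, x * y ≠ y * x)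
    (hgen : ∃ a b : G, Subgroup.closure {a, b} = ⊤) :
    ∃ a b : G, Subgroup.closure {a, b} = ⊤ ∧ a * a ≠ 1 ∧ a * b ≠ b * a := by
  obtain ⟨x, y, hxy⟩ := hna
  obtain ⟨a, b, h⟩ := hgen
  have key : ∀ c d : G, Subgroup.closure {c, d} = ⊤ → c * d ≠ d * c := fun c d hcd hc =>
    hxy (commute_of_closure_pair_eq_top hcd hc x y)
  by_cases ha : a * a = 1
  · by_cases hb : b * b = 1
    · have h' : Subgroup.closure {a * b, b} = ⊤ := by
        rw [eq_top_iff, ← h, Subgroup.closure_le]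
        have h₁ : a * b ∈ Subgroup.closure {a * b, b} := Subgroup.subset_closure (by simp)
        have h₂ : b ∈ Subgroup.closure {a * b, b} := Subgroup.subset_closure (by simp)
        rintro z (rfl | rfl)
        · simpa using mul_mem h₁ (inv_mem h₂)
        · exact h₂
      refine ⟨a * b, b, h', fun hab => key a b h ?_, key _ _ h'⟩
      rw [eq_inv_of_mul_eq_one_left hab, mul_inv_rev, ← eq_inv_of_mul_eq_one_left ha,
        ← eq_inv_of_mul_eq_one_left hb]
    · have h' : Subgroup.closure {b, a} = ⊤ := by rwa [Set.pair_comm]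
      exact ⟨b, a, h', hb, key _ _ h'⟩
  · exact ⟨a, b, h, ha, key _ _ h⟩

section CyclicVoltage

variable {G : Type*} [Group G] {m : ℕ}

open Classical in
/-- The label of the arcs from layer `i` to layer `i + 1`: it is `b` on the last layer and `1`
on all others. -/
noncomputable def stepLabel (m : ℕ) (b : G) (i : ZMod m) : G := if i = -1 then b else 1

/-- The connection sets with `T i i = {a}` and `T i (i + 1) = {stepLabel m b i}`. -/
def cyclicConn (m : ℕ) (a b : G) (i j : ZMod m) : Set G :=
  {s | (j = i ∧ s = a) ∨ (j = i + 1 ∧ s = stepLabel m b i)}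

theorem stepLabel_neg_one (b : G) : stepLabel m b (-1) = b := by simp [stepLabel]

theorem stepLabel_of_ne (b : G) {i : ZMod m} (hi : i ≠ -1) : stepLabel m b i = 1 := by
  simp [stepLabel, hi]

theorem mCayleyArc_cyclicConn {a b : G} {x y : G × ZMod m} :
    mCayleyArc (cyclicConn m a b) x y ↔
      y = (a * x.1, x.2) ∨ y = (stepLabel m b x.2 * x.1, x.2 + 1) := by
  obtain ⟨g, i⟩ := x
  obtain ⟨h, j⟩ := y
  simp only [mCayleyArc, cyclicConn, Set.mem_ofPred_eq, Prod.mk.injEq]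
  constructor
  · rintro ⟨t, ⟨rfl, rfl⟩ | ⟨rfl, rfl⟩, rfl⟩ <;> simp
  · rintro (⟨rfl, rfl⟩ | ⟨rfl, rfl⟩)
    · exact ⟨a, by simp, rfl⟩
    · exact ⟨_, Or.inr ⟨rfl, rfl⟩, rfl⟩

theorem isOrientedRel_cyclicConn [Fact (1 < m)] {a b : G} (ha : a * a ≠ 1) (hb : b ≠ 1) :
    IsOrientedRel (mCayleyArc (cyclicConn m a b)) := by
  rintro ⟨g, i⟩ y hxy hyx
  rw [mCayleyArc_cyclicConn] at hxy hyx
  rcases hxy with rfl | rfl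
  · rcases hyx with h | h <;> simp only [Prod.mk.injEq] at h
    · rw [← mul_assoc] at h
      exact ha (by simpa using h.1.symm)
    · simp at h
  · rcases hyx with h | h <;> simp only [Prod.mk.injEq] at h
    · simp at h
    · obtain ⟨h₁, h₂⟩ := h
      rw [← mul_assoc, eq_comm, mul_eq_right] at h₁
      have hm : ((2 : ℕ) : ZMod m) = 0 := by
        rw [add_assoc, eq_comm, add_eq_left, one_add_one_eq_two] at h₂
        exact_mod_cast h₂
      obtain rfl : m = 2 :=
        le_antisymm (Nat.le_of_dvd two_pos ((ZMod.natCast_eq_zero_iff 2 m).1 hm))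
          (Fact.out : 1 < m)
      have hi : i = 0 ∨ i = -1 := (by decide : ∀ j : ZMod 2, j = 0 ∨ j = -1) i
      rcases hi with rfl | rfl
      · rw [stepLabel_of_ne b (i := (0 : ZMod 2)) (by decide),
          show (0 + 1 : ZMod 2) = -1 by decide, stepLabel_neg_one, mul_one] at h₁
        exact hb h₁
      · rw [stepLabel_neg_one, stepLabel_of_ne b (by decide), one_mul] at h₁
        exact hb h₁

theorem ncard_outNeighbors_cyclicConn [Fact (1 < m)] (a b : G) (x : G × ZMod m) :
    {y | mCayleyArc (cyclicConn m a b) x y}.ncard = 2 := by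
  have h : {y | mCayleyArc (cyclicConn m a b) x y} =
      {(a * x.1, x.2), (stepLabel m b x.2 * x.1, x.2 + 1)} := by
    ext y
    simp [mCayleyArc_cyclicConn]
  rw [h, Set.ncard_pair]
  simp

theorem ncard_inNeighbors_cyclicConn [Fact (1 < m)] (a b : G) (x : G × ZMod m) :
    {y | mCayleyArc (cyclicConn m a b) y x}.ncard = 2 := by
  have h : {y | mCayleyArc (cyclicConn m a b) y x} =
      {(a⁻¹ * x.1, x.2), ((stepLabel m b (x.2 - 1))⁻¹ * x.1, x.2 - 1)} := by
    ext ⟨h, j⟩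
    obtain ⟨g, i⟩ := x
    simp only [mCayleyArc_cyclicConn, Set.mem_ofPred_eq, Set.mem_insert_iff,
      Set.mem_singleton_iff, Prod.mk.injEq]
    constructor
    · rintro (⟨rfl, rfl⟩ | ⟨rfl, rfl⟩) <;> simp
    · rintro (⟨rfl, rfl⟩ | ⟨rfl, rfl⟩) <;> simp
  rw [h, Set.ncard_pair]
  simp [eq_sub_iff_add_eq]

/-- Two distinct out-neighbours of `v` have a common out-neighbour. -/
def HasOutDiamond {V : Type*} (A : V → V → Prop) (v : V) : Prop :=
  ∃ u w z, u ≠ w ∧ A v u ∧ A v w ∧ A u z ∧ A w z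

theorem IsDigraphAuto.symm {V : Type*} {A : V → V → Prop} {σ : Equiv.Perm V}
    (hσ : IsDigraphAuto A σ) : IsDigraphAuto A σ.symm := fun x y => by
  simpa using (hσ (σ.symm x) (σ.symm y)).symm

theorem IsDigraphAuto.hasOutDiamond {V : Type*} {A : V → V → Prop} {σ : Equiv.Perm V}
    (hσ : IsDigraphAuto A σ) {v : V} (h : HasOutDiamond A v) : HasOutDiamond A (σ v) := by
  obtain ⟨u, w, z, huw, h₁, h₂, h₃, h₄⟩ := h
  exact ⟨σ u, σ w, σ z, σ.injective.ne huw, (hσ _ _).2 h₁, (hσ _ _).2 h₂, (hσ _ _).2 h₃,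
    (hσ _ _).2 h₄⟩

theorem hasOutDiamond_cyclicConn [Fact (1 < m)] {a b : G} (hab : a * b ≠ b * a)
    (v : G × ZMod m) :
    HasOutDiamond (mCayleyArc (cyclicConn m a b)) v ↔ v.2 ≠ -1 := by
  obtain ⟨g, i⟩ := v
  constructor
  · rintro ⟨u, w, z, huw, hu, hw, huz, hwz⟩ rfl
    have h0 : (0 : ZMod m) ≠ -1 := by simp
    have key : ¬ ∃ z, mCayleyArc (cyclicConn m a b) (a * g, -1) z ∧
        mCayleyArc (cyclicConn m a b) (b * g, 0) z := by
      rintro ⟨z, h₁, h₂⟩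
      simp only [mCayleyArc_cyclicConn, stepLabel_neg_one, stepLabel_of_ne b h0, one_mul] at h₁ h₂
      rcases h₁ with rfl | rfl <;> rcases h₂ with h | h <;>
        simp only [Prod.mk.injEq, ← mul_assoc, mul_left_inj] at h
      · exact h0 h.2.symm
      · exact hab (by rw [← h.1, mul_assoc])
      · exact hab h.1.symm
      · simp at h
    simp only [mCayleyArc_cyclicConn (x := (g, -1)), stepLabel_neg_one, neg_add_cancel] at hu hw
    rcases hu with rfl | rfl <;> rcases hw with rfl | rfl
    · exact huw rfl
    · exact key ⟨z, huz, hwz⟩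
    · exact key ⟨z, hwz, huz⟩
    · exact huw rfl
  · intro hi
    refine ⟨(a * g, i), (g, i + 1), (a * g, i + 1), by simp, ?_⟩
    simp [mCayleyArc_cyclicConn, stepLabel_of_ne b hi]

theorem IsDigraphAuto.snd_eq_natCast [Fact (1 < m)] {a b : G} (hab : a * b ≠ b * a) (n : ℕ)
    {σ : Equiv.Perm (G × ZMod m)} (hσ : IsDigraphAuto (mCayleyArc (cyclicConn m a b)) σ)
    {v : G × ZMod m} (hv : v.2 = -1 + n) : (σ v).2 = -1 + n := by
  induction n generalizing σ v with
  | zero =>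
    simp only [Nat.cast_zero, add_zero] at hv ⊢
    by_contra h
    rw [← ne_eq, ← hasOutDiamond_cyclicConn hab] at h
    have h' := hσ.symm.hasOutDiamond h
    rw [Equiv.symm_apply_apply, hasOutDiamond_cyclicConn hab] at h'
    exact h' hv
  | succ n ih =>
    obtain ⟨h, j⟩ := v
    set i : ZMod m := -1 + n with hi
    obtain rfl : j = i + 1 := by
      rw [hi]
      push_cast at hv
      rw [← add_assoc] at hv
      exact hv
    have harc : mCayleyArc (cyclicConn m a b) ((stepLabel m b i)⁻¹ * h, i) (h, i + 1) := by
      simp [mCayleyArc_cyclicConn]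
    have hu := ih hσ (v := ((stepLabel m b i)⁻¹ * h, i)) rfl
    have himg := (hσ _ _).2 harc
    rw [mCayleyArc_cyclicConn, hu] at himg
    rcases himg with himg | himg
    · have := ih hσ.symm (v := σ (h, i + 1)) (by rw [himg])
      simp at this
    · rw [himg]
      push_cast
      rw [hi, add_assoc]

theorem IsDigraphAuto.snd_apply [Fact (1 < m)] {a b : G} (hab : a * b ≠ b * a)
    {σ : Equiv.Perm (G × ZMod m)} (hσ : IsDigraphAuto (mCayleyArc (cyclicConn m a b)) σ)
    (v : G × ZMod m) : (σ v).2 = v.2 := by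
  have : NeZero m := ⟨(zero_lt_one.trans (Fact.out : 1 < m)).ne'⟩
  have hv : v.2 = -1 + ((v.2 + 1).val : ZMod m) := by simp
  exact (hσ.snd_eq_natCast hab _ hv).trans hv.symm

theorem IsDigraphAuto.eq_rightTransl [Fact (1 < m)] {a b : G}
    (hgen : Subgroup.closure {a, b} = ⊤) (hab : a * b ≠ b * a)
    {σ : Equiv.Perm (G × ZMod m)} (hσ : IsDigraphAuto (mCayleyArc (cyclicConn m a b)) σ) :
    ∃ h : G, σ = rightTransl m h := by
  have : NeZero m := ⟨(zero_lt_one.trans (Fact.out : 1 < m)).ne'⟩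
  have hsnd := hσ.snd_apply hab
  have hloop : ∀ g i, (σ (a * g, i)).1 = a * (σ (g, i)).1 := fun g i => by
    have h := (hσ (g, i) (a * g, i)).2 (by simp [mCayleyArc_cyclicConn])
    rw [mCayleyArc_cyclicConn] at h
    rcases h with h | h
    · rw [h]
    · have := congrArg Prod.snd h
      simp [hsnd] at this
  have hstep : ∀ g i, (σ (stepLabel m b i * g, i + 1)).1 = stepLabel m b i * (σ (g, i)).1 :=
    fun g i => by
    have h := (hσ (g, i) (stepLabel m b i * g, i + 1)).2 (by simp [mCayleyArc_cyclicConn])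
    rw [mCayleyArc_cyclicConn] at h
    rcases h with h | h
    · have := congrArg Prod.snd h
      simp [hsnd] at this
    · rw [h, hsnd]
  have hfst_natCast : ∀ n : ℕ, n < m → ∀ g, (σ (g, (n : ZMod m))).1 = (σ (g, 0)).1 := by
    intro n
    induction n with
    | zero => simp
    | succ n ih =>
      intro hn g
      have hne : (n : ZMod m) ≠ -1 := by
        intro h
        have h' : ((n + 1 : ℕ) : ZMod m) = 0 := by simp [h]
        exact Nat.not_le_of_lt hn
          (Nat.le_of_dvd n.succ_pos ((ZMod.natCast_eq_zero_iff _ _).1 h'))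
      have h := hstep g n
      rw [stepLabel_of_ne b hne, one_mul, one_mul] at h
      rw [Nat.cast_succ, h, ih (Nat.lt_of_succ_lt hn)]
  have hfst : ∀ g i, (σ (g, i)).1 = (σ (g, 0)).1 := fun g i => by
    simpa using hfst_natCast i.val i.val_lt g
  have hb : ∀ g, (σ (b * g, 0)).1 = b * (σ (g, 0)).1 := fun g => by
    simpa [stepLabel_neg_one, hfst g (-1)] using hstep g (-1)
  have hmul : ∀ s g, (σ (s * g, 0)).1 = s * (σ (g, 0)).1 := by
    intro s
    have hs : s ∈ Subgroup.closure {a, b} := hgen ▸ Subgroup.mem_top s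
    induction hs using Subgroup.closure_induction with
    | mem s hs =>
      rcases hs with rfl | rfl
      · exact fun g => hloop g 0
      · exact hb
    | one => simp
    | mul s t _ _ hs ht => intro g; rw [mul_assoc, hs, ht, mul_assoc]
    | inv s _ hs =>
      intro g
      rw [eq_inv_mul_iff_mul_eq, ← hs, mul_inv_cancel_left]
  refine ⟨(σ (1, 0)).1, Equiv.ext fun ⟨g, i⟩ => Prod.ext ?_ (hsnd _)⟩
  simpa [rightTransl, hfst g i] using hmul g 1

theorem isDigraphAuto_rightTransl (T : ZMod m → ZMod m → Set G) (h : G) :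
    IsDigraphAuto (mCayleyArc T) (rightTransl m h) := fun x y => by
  simp [mCayleyArc, rightTransl, ← mul_assoc]

end CyclicVoltage

/-- Every finite non-abelian group generated by two elements admits an OmSR of
valency two for every integer `m ≥ 2`. -/
theorem nonabelian_two_generated_omsr
    (G : Type*) [Group G] [Fintype G] (hna : ∃ x y : G, x * y ≠ y * x)
    (hgen : ∃ a b : G, Subgroup.closure {a, b} = ⊤)
    (m : ℕ) (hm : 2 ≤ m) :
    HasOmSRValencyTwo G m := by
  have : Fact (1 < m) := ⟨hm⟩
  obtain ⟨a, b, hgen, ha, hab⟩ := exists_generators_sq_ne_one hna hgen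
  have hb : b ≠ 1 := by
    rintro rfl
    simp at hab
  refine ⟨cyclicConn m a b, isOrientedRel_cyclicConn ha hb, ncard_outNeighbors_cyclicConn a b,
    ncard_inNeighbors_cyclicConn a b, fun σ => ⟨fun hσ => hσ.eq_rightTransl hgen hab, ?_⟩⟩
  rintro ⟨h, rfl⟩
  exact isDigraphAuto_rightTransl _ h
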